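/- Let p ≥ 5 be prime, let k be a positive integer with p ∤ k and k ≡ 1 (mod 3), and let φ(x) = x^p + kp·x^{p−1} − kp ∈ ℤ[x]. Then for every n ≥ 1 the Galois group Gal(K_n/K_{n−1}) of the splitting-field tower of the iterates of φ is maximal, i.e. has order (p!)^{p^{n−1}}. Moreover, the same conclusion holds for p = 3, k = 2, i.e. for φ(x) = x^3 + 6x^2 − 6, the group Gal(K_n/K_{n−1}) has order (3!)^{3^{n−1}} for every n ≥ 1. (This says the arboreal Galois representation of φ over ℚ is surjective, proving Odoni's conjecture in all prime degrees.) -/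

import Mathlib

open Polynomial

noncomputable section

/-- The `n`-th iterate of a polynomial under composition: `polyIter φ 0 = X`,
`polyIter φ (n+1) = φ ∘ (polyIter φ n)`. -/
def polyIter {R : Type*} [CommRing R] (φ : Polynomial R) : ℕ → Polynomial R
  | 0 => X
  | n + 1 => φ.comp (polyIter φ n)

/-- The splitting field `K_n` of the `n`-th iterate of `φ ∈ ℤ[x]` over `ℚ`, inside a fixed
algebraic closure of `ℚ`. -/
def Kfield (φ : Polynomial ℤ) (n : ℕ) : IntermediateField ℚ (AlgebraicClosure ℚ) :=
  IntermediateField.adjoin ℚ ((polyIter φ n).rootSet (AlgebraicClosure ℚ))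

/-- The order of `Gal(K_n / K_{n-1})`: the number of automorphisms of `K_n` over `ℚ`
fixing every element of `K_{n-1}` pointwise. -/
def relGalCard (φ : Polynomial ℤ) (n : ℕ) : ℕ :=
  Nat.card {σ : Kfield φ n ≃ₐ[ℚ] Kfield φ n //
    ∀ (x : AlgebraicClosure ℚ) (_ : x ∈ Kfield φ (n - 1)) (hx' : x ∈ Kfield φ n),
      σ ⟨x, hx'⟩ = ⟨x, hx'⟩}

end

/-- A subgroup of `Perm α` containing the swaps within the fibres of `f` contains every
permutation preserving these fibres. -/
theorem Subgroup.mem_of_comp_eq_of_swap_mem {α β : Type*} [Fintype α] [DecidableEq α] (f : α → β)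
    (G : Subgroup (Equiv.Perm α)) (h : ∀ x y, f x = f y → Equiv.swap x y ∈ G)
    (g : Equiv.Perm α) (hg : ∀ x, f (g x) = f x) : g ∈ G := by
  induction hn : g.support.card using Nat.strong_induction_on generalizing g with
  | _ n ih =>
    by_cases h1 : g = 1
    · exact h1 ▸ G.one_mem
    obtain ⟨x, hx⟩ : ∃ x, g x ≠ x := by
      by_contra! hc
      exact h1 (Equiv.ext hc)
    have hs : Equiv.swap x (g x) ∈ G := h _ _ (hg x).symm
    have := ih _ (hn ▸ Equiv.Perm.card_support_swap_mul hx) (Equiv.swap x (g x) * g) (fun y => by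
      rw [Equiv.Perm.mul_apply, ← hg y]
      rcases eq_or_ne (g y) x with h2 | h2
      · rw [h2, Equiv.swap_apply_left, hg]
      rcases eq_or_ne (g y) (g x) with h3 | h3
      · rw [h3, Equiv.swap_apply_right, hg]
      rw [Equiv.swap_apply_of_ne_of_ne h2 h3]) rfl
    exact (G.mul_mem_cancel_left hs).1 this

/-- A transitive group of permutations preserving the partition into the fibres of `f`, all of
which have the same prime cardinality `p ≥ 3`, contains the full group of permutations fixing each
fibre as soon as it contains a transposition. -/
theorem Subgroup.mem_of_comp_eq_of_isSwap {α β : Type*} [Fintype α] [DecidableEq α] [DecidableEq β]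
    (f : α → β) (G : Subgroup (Equiv.Perm α)) {p : ℕ} (hp : p.Prime) (hp3 : 3 ≤ p)
    (hcard : ∀ x, (Finset.univ.filter fun y => f y = f x).card = p)
    (htrans : ∀ x y, ∃ g ∈ G, g x = y)
    (hblock : ∀ g ∈ G, ∀ x y, f x = f y → f (g x) = f (g y))
    (hswap : ∃ a b, a ≠ b ∧ Equiv.swap a b ∈ G)
    (g : Equiv.Perm α) (hg : ∀ x, f (g x) = f x) : g ∈ G := by
  classical
  have hrefl : ∀ x, Equiv.swap x x ∈ G := fun x => by
    rw [Equiv.swap_self]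
    exact G.one_mem
  have hsub : ∀ a b, Equiv.swap a b ∈ G → f a = f b := by
    intro a b hab
    by_contra hne
    have hne' : a ≠ b := fun h => hne (h ▸ rfl)
    obtain ⟨z, hz, hza⟩ := Finset.exists_mem_ne
      (by rw [hcard a]; omega : 1 < (Finset.univ.filter fun y => f y = f a).card) a
    simp only [Finset.mem_filter, Finset.mem_univ, true_and] at hz
    have hzb : z ≠ b := fun h => hne (h ▸ hz).symm
    have := hblock _ hab z a hz
    rw [Equiv.swap_apply_of_ne_of_ne hza hzb, Equiv.swap_apply_left] at this
    exact hne (hz.symm.trans this)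
  let s : Setoid α :=
    { r := fun x y => Equiv.swap x y ∈ G
      iseqv :=
        { refl := hrefl
          symm := fun {x y} h => by rwa [Equiv.swap_comm]
          trans := fun {x y z} hxy hyz => by
            by_cases h1 : x = y
            · exact h1 ▸ hyz
            by_cases h2 : x = z
            · exact h2 ▸ hrefl x
            rw [Equiv.swap_comm, ← Equiv.swap_mul_swap_mul_swap h1 h2]
            exact G.mul_mem (G.mul_mem hyz hxy) hyz } }
  have hconj : ∀ g ∈ G, ∀ x y, Equiv.swap x y ∈ G → Equiv.swap (g x) (g y) ∈ G := by
    intro g hg x y h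
    rw [Equiv.swap_apply_apply]
    exact G.mul_mem (G.mul_mem hg h) (G.inv_mem hg)
  let cls : α → Finset α := fun x => Finset.univ.filter fun y => Equiv.swap x y ∈ G
  have hle : ∀ x y, (cls x).card ≤ (cls y).card := by
    intro x y
    obtain ⟨g, hg, rfl⟩ := htrans x y
    refine Finset.card_le_card_of_injOn g (fun z hz => ?_) g.injective.injOn
    simp only [cls, Finset.coe_filter, Finset.mem_univ, true_and, Set.mem_ofPred_eq] at hz ⊢
    exact hconj g hg _ _ hz
  obtain ⟨a, b, hab, hsw⟩ := hswap
  have h2 : ∀ x, 2 ≤ (cls x).card := fun x => by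
    refine le_trans ?_ (hle a x)
    rw [← Finset.card_pair hab]
    refine Finset.card_le_card fun z hz => ?_
    simp only [Finset.mem_insert, Finset.mem_singleton] at hz
    rcases hz with rfl | rfl
    · simpa [cls] using hrefl z
    · simpa [cls] using hsw
  have hfull : ∀ x, cls x = Finset.univ.filter fun y => f y = f x := by
    intro x
    have hcs : cls x ⊆ Finset.univ.filter fun y => f y = f x := fun y hy => by
      simp only [cls, Finset.mem_filter, Finset.mem_univ, true_and] at hy ⊢
      exact (hsub _ _ hy).symm
    refine Finset.eq_of_subset_of_card_le hcs ?_
    have hdvd : (cls x).card ∣ p := by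
      rw [← hcard x, Finset.card_eq_sum_card_image (Quotient.mk s)
        (Finset.univ.filter fun y => f y = f x)]
      refine Finset.dvd_sum fun c hc => ?_
      obtain ⟨y, hy, rfl⟩ := Finset.mem_image.1 hc
      simp only [Finset.mem_filter, Finset.mem_univ, true_and] at hy
      rw [le_antisymm (hle x y) (hle y x)]
      refine dvd_of_eq (congrArg Finset.card ?_)
      ext z
      simp only [cls, Finset.mem_filter, Finset.mem_univ, true_and, Quotient.eq]
      constructor
      · intro h
        exact ⟨(hsub _ _ h).symm.trans hy, s.symm h⟩
      · intro h
        exact s.symm h.2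
    rw [hcard x, ((Nat.dvd_prime hp).1 hdvd).resolve_left (by have := h2 x; omega)]
  refine G.mem_of_comp_eq_of_swap_mem f (fun x y hxy => ?_) g hg
  have : y ∈ cls x := by
    rw [hfull x]
    simpa using hxy.symm
  simpa [cls] using this

theorem Polynomial.aeval_apply_int {A B : Type*} [CommRing A] [CommRing B] [Algebra ℤ A]
    [Algebra ℤ B] (f : A →+* B) (x : A) (F : ℤ[X]) : aeval (f x) F = f (aeval x F) := by
  rw [aeval_def, aeval_def, hom_eval₂, RingHom.ext_int (f.comp _) (algebraMap ℤ B)]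

section Collision

variable {S : Type*} [CommRing S] {Q : Ideal S} {F V : S[X]} {c : S}

/-- If `F' = (X - c) V` where `F` and `V` have no common root modulo `Q`, then the value `F(c)` is
the square of `x - c` up to a unit at `Q`, for any root `x` of `F` reducing to `c`. -/
theorem Polynomial.exists_eval_eq_sq_mul_of_derivative_eq (hF : derivative F = (X - C c) * V)
    (hV : ∀ x, F.eval x ∈ Q → V.eval x ∉ Q) {x : S} (hx : F.IsRoot x) (hxc : x - c ∈ Q) :
    ∃ u, u ∉ Q ∧ F.eval c = (x - c) ^ 2 * u := by
  obtain ⟨W, hW⟩ := X_sub_C_dvd_sub_C_eval (p := F) (a := c)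
  have hW' : W = (X - C c) * (V - derivative W) := by
    have := congrArg derivative hW
    simp only [derivative_sub, derivative_C, derivative_mul, derivative_X, hF] at this
    linear_combination -this
  set U := V - derivative W with hU
  have hUV : 2 * U = V - (X - C c) * derivative U := by
    have := congrArg derivative hW'
    simp only [derivative_sub, derivative_C, derivative_mul, derivative_X] at this
    linear_combination hU - this
  refine ⟨-U.eval x, fun h => ?_, ?_⟩
  · have h1 := congrArg (eval x) hUV
    simp only [eval_mul, eval_ofNat, eval_sub, eval_X, eval_C] at h1
    refine hV x (by rw [hx]; exact Q.zero_mem) ?_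
    rw [show V.eval x = 2 * U.eval x + (x - c) * (derivative U).eval x by linear_combination -h1]
    exact Q.add_mem (Q.mul_mem_left _ (neg_mem_iff.1 h)) (Q.mul_mem_right _ hxc)
  · rw [hW'] at hW
    have h1 := congrArg (eval x) hW
    have hx0 : F.eval x = 0 := hx
    simp only [eval_mul, eval_sub, eval_X, eval_C, hx0] at h1
    linear_combination -h1

variable [IsDomain S] [Q.IsPrime]

theorem Polynomial.exists_eq_mul_mul_of_isRoot {x y : S} (hx : F.IsRoot x) (hy : F.IsRoot y)
    (hxy : x ≠ y) : ∃ R, F = (X - C x) * ((X - C y) * R) ∧ ∀ z, F.IsRoot z → z ≠ x → z ≠ y →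
      R.IsRoot z := by
  obtain ⟨R₁, rfl⟩ := dvd_iff_isRoot.2 hx
  have h1 : ∀ z, ((X - C x) * R₁).IsRoot z → z ≠ x → R₁.IsRoot z := fun z hz hzx => by
    simpa [sub_eq_zero, hzx] using hz
  obtain ⟨R, rfl⟩ := dvd_iff_isRoot.2 (h1 y hy hxy.symm)
  refine ⟨R, rfl, fun z hz hzx hzy => ?_⟩
  simpa [sub_eq_zero, hzy] using h1 z hz hzx

/-- If `F' = (X - c) V` where `F` and `V` have no common root modulo the prime `Q`, then two roots
of `F` can only collide modulo `Q` at `c`. -/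
theorem Polynomial.sub_mem_of_sub_mem_of_derivative_eq (hF : derivative F = (X - C c) * V)
    (hV : ∀ x, F.eval x ∈ Q → V.eval x ∉ Q) {x y : S} (hx : F.IsRoot x) (hy : F.IsRoot y)
    (hxy : x ≠ y) (h : y - x ∈ Q) : x - c ∈ Q := by
  obtain ⟨R, hR, -⟩ := exists_eq_mul_mul_of_isRoot hx hy hxy
  have h1 : (derivative F).eval x = (x - y) * R.eval x := by
    rw [hR]
    simp
  have h2 : (x - c) * V.eval x ∈ Q := by
    have : (derivative F).eval x = (x - c) * V.eval x := by simp [hF]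
    rw [← this, h1, ← neg_sub y x]
    exact Q.mul_mem_right _ (Q.neg_mem h)
  refine (Ideal.IsPrime.mem_or_mem inferInstance h2).resolve_right (hV x ?_)
  rw [hx]
  exact Q.zero_mem

/-- In the situation of `Polynomial.sub_mem_of_sub_mem_of_derivative_eq`, at most two roots of `F`
reduce to `c`. -/
theorem Polynomial.eq_or_eq_of_sub_mem_of_derivative_eq (hF : derivative F = (X - C c) * V)
    (hV : ∀ x, F.eval x ∈ Q → V.eval x ∉ Q) {x y z : S} (hx : F.IsRoot x) (hy : F.IsRoot y)
    (hz : F.IsRoot z) (hxy : x ≠ y) (hxc : x - c ∈ Q) (hyc : y - c ∈ Q) (hzc : z - c ∈ Q) :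
    z = x ∨ z = y := by
  by_contra! hne
  obtain ⟨R, hR, hroot⟩ := exists_eq_mul_mul_of_isRoot hx hy hxy
  obtain ⟨T, rfl⟩ := dvd_iff_isRoot.2 (hroot z hz hne.1 hne.2)
  let π := Ideal.Quotient.mk Q
  have hπ : ∀ {u}, u - c ∈ Q → π u = π c := fun hu => Ideal.Quotient.eq.2 hu
  have hFq : F.map π = (X - C (π c)) * ((X - C (π c)) * ((X - C (π c)) * T.map π)) := by
    rw [hR]
    simp only [Polynomial.map_mul, Polynomial.map_sub, map_X, map_C, hπ hxc, hπ hyc, hπ hzc]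
  have hd : (X - C (π c)) * V.map π = (X - C (π c)) *
      ((X - C (π c)) * (3 * T.map π + (X - C (π c)) * derivative (T.map π))) := by
    have h1 : derivative (F.map π) = (X - C (π c)) * V.map π := by
      rw [derivative_map, hF]
      simp
    rw [← h1, hFq]
    simp only [derivative_mul, derivative_sub, derivative_X, derivative_C]
    ring
  have hVc : V.map π = _ := mul_left_cancel₀ (X_sub_C_ne_zero _) hd
  have h0 : π (V.eval c) = 0 := by
    rw [← eval_map_apply, hVc]
    simp
  refine hV c ?_ (Ideal.Quotient.eq_zero_iff_mem.1 h0)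
  refine Ideal.Quotient.eq_zero_iff_mem.1 (?_ : π _ = 0)
  rw [← eval_map_apply, hFq]
  simp

end Collision

open NumberField in
/-- Let `L` be a Galois number field generated by the roots of a monic `F ∈ ℤ[X]` with
`F' = (X - c) V`. If `F` and `V` have no common root in characteristic `q` and `F(c)` has odd
valuation at `q`, then some automorphism of `L` acts as a transposition on the roots of `F`. -/
theorem NumberField.exists_swap_of_derivative_eq (L : Type) [Field L] [NumberField L]
    [IsGalois ℚ L] {F V : ℤ[X]} {c : ℤ} (hmonic : F.Monic)
    (hsplits : (F.map (algebraMap ℤ L)).Splits)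
    (hgen : ∀ σ : L ≃ₐ[ℚ] L, (∀ x, aeval x F = 0 → σ x = x) → σ = 1)
    (hF : derivative F = (X - C c) * V) {q m : ℕ} {w : ℤ} (hq : q.Prime)
    (hV : ∀ (k : Type) [Field k] [CharP k q] (x : k), aeval x F = 0 → aeval x V ≠ 0)
    (hFc : F.eval c = (q : ℤ) ^ (2 * m + 1) * w) (hw : ¬ (q : ℤ) ∣ w) :
    ∃ (σ : L ≃ₐ[ℚ] L) (a b : L), a ≠ b ∧ aeval a F = 0 ∧ aeval b F = 0 ∧ σ a = b ∧ σ b = a ∧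
      ∀ x, aeval x F = 0 → x ≠ a → x ≠ b → σ x = x := by
  have hqp : Prime (q : ℤ) := Nat.prime_iff_prime_int.1 hq
  have : Fact q.Prime := ⟨hq⟩
  let p : Ideal ℤ := Ideal.span {(q : ℤ)}
  have hp0 : p ≠ ⊥ := by simp [p, hq.ne_zero]
  have hpp : p.IsPrime := (Ideal.span_singleton_prime hqp.ne_zero).2 hqp
  have : p.IsMaximal := hpp.isMaximal hp0
  obtain ⟨⟨Q, hQp, hQover⟩⟩ : Nonempty (p.primesOver (𝓞 L)) := inferInstance
  have hmap0 : p.map (algebraMap ℤ (𝓞 L)) ≠ ⊥ := Ideal.map_ne_bot_of_ne_bot hp0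
  have hQ0 : Q ≠ ⊥ := Ideal.ne_bot_of_liesOver_of_ne_bot hp0 Q
  have hQprime : Prime Q := Ideal.prime_of_isPrime hQ0 hQp
  have : Q.IsMaximal := hQp.isMaximal hQ0
  have hmemQ : ∀ a : ℤ, algebraMap ℤ (𝓞 L) a ∈ Q ↔ (q : ℤ) ∣ a := fun a => by
    rw [← Ideal.mem_span_singleton, ← Ideal.mem_comap, ← Ideal.under_def, ← hQover.over]
  let F' := F.map (algebraMap ℤ (𝓞 L))
  let V' := V.map (algebraMap ℤ (𝓞 L))
  have hF' : derivative F' = (X - C (algebraMap ℤ (𝓞 L) c)) * V' := by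
    simp only [F', V', derivative_map, hF]
    simp
  have hV' : ∀ x, F'.eval x ∈ Q → V'.eval x ∉ Q := by
    let := Ideal.Quotient.field Q
    have : CharP (𝓞 L ⧸ Q) q := by
      refine (CharP.charP_iff_prime_eq_zero hq).2 ?_
      have := (hmemQ q).2 dvd_rfl
      rw [← Ideal.Quotient.eq_zero_iff_mem] at this
      simpa using this
    have key : ∀ (G : ℤ[X]) (x : 𝓞 L), (G.map (algebraMap ℤ (𝓞 L))).eval x ∈ Q ↔
        aeval (Ideal.Quotient.mk Q x) G = 0 := fun G x => by
      rw [← Ideal.Quotient.eq_zero_iff_mem, eval_map_algebraMap, ← Ideal.Quotient.algebraMap_eq,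
        aeval_algebraMap_apply]
    intro x hx
    rw [key] at hx ⊢
    exact hV _ _ hx
  have hroot : ∀ x : 𝓞 L, F'.IsRoot x ↔ aeval (x : L) F = 0 := fun x => by
    rw [IsRoot, eval_map_algebraMap, aeval_algebraMap_apply]
    simp
  have hlift : ∀ x : L, aeval x F = 0 → ∃ y : 𝓞 L, (y : L) = x := fun x hx =>
    ⟨⟨x, ⟨F, hmonic, hx⟩⟩, rfl⟩
  have hsplit' : F'.Splits := by
    refine Splits.of_splits_map_of_injective (i := algebraMap (𝓞 L) L)
      (FaithfulSMul.algebraMap_injective _ _) ?_ fun a ha => ?_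
    · rwa [Polynomial.map_map, ← IsScalarTower.algebraMap_eq]
    · rw [Polynomial.map_map, ← IsScalarTower.algebraMap_eq] at ha
      obtain ⟨y, hy⟩ := hlift a (by
        rw [← eval_map_algebraMap]
        exact (mem_roots'.1 ha).2)
      exact ⟨y, hy⟩
  obtain ⟨x₀, hx₀, hx₀c⟩ : ∃ x, F'.IsRoot x ∧ x - algebraMap ℤ (𝓞 L) c ∈ Q := by
    have h1 : F'.eval (algebraMap ℤ (𝓞 L) c) ∈ Q := by
      rw [eval_map_algebraMap, aeval_algebraMap_apply, hmemQ, coe_aeval_eq_eval, hFc]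
      exact Dvd.dvd.mul_right (dvd_pow_self _ (by omega)) _
    rw [hsplit'.eval_eq_prod_roots_of_monic (hmonic.map _),
      Ideal.IsPrime.multiset_prod_mem_iff_exists_mem hQp] at h1
    obtain ⟨y, hy, hyQ⟩ := h1
    obtain ⟨x, hx, rfl⟩ := Multiset.mem_map.1 hy
    exact ⟨x, (mem_roots'.1 hx).2, by simpa using Q.neg_mem hyQ⟩
  obtain ⟨u, huQ, hu⟩ := exists_eval_eq_sq_mul_of_derivative_eq hF' hV' hx₀ hx₀c
  have hinertia : Q.inertia (L ≃ₐ[ℚ] L) ≠ ⊥ := by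
    intro hbot
    have hcard := Ideal.card_inertia_eq_ramificationIdxIn (G := L ≃ₐ[ℚ] L) p Q
    rw [hbot, Subgroup.card_bot, Ideal.ramificationIdxIn_eq_ramificationIdx p Q (L ≃ₐ[ℚ] L),
      Ideal.IsDedekindDomain.ramificationIdx_eq_multiplicity p Q hmap0] at hcard
    have hemul : emultiplicity Q (Ideal.span {algebraMap ℤ (𝓞 L) q}) = 1 := by
      rw [← Set.image_singleton, ← Ideal.map_span,
        (FiniteMultiplicity.of_prime_left hQprime hmap0).emultiplicity_eq_multiplicity, ← hcard]
      rfl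
    have hnot : ∀ {v : 𝓞 L}, v ∉ Q → emultiplicity Q (Ideal.span {v}) = 0 := fun hv => by
      rwa [emultiplicity_eq_zero, Ideal.dvd_span_singleton]
    have heq := congrArg (fun v => emultiplicity Q (Ideal.span {v})) hu
    simp only [F', eval_map_algebraMap, aeval_algebraMap_apply, coe_aeval_eq_eval, hFc, map_mul,
      map_pow, ← Ideal.span_singleton_mul_span_singleton, ← Ideal.span_singleton_pow,
      emultiplicity_mul hQprime, emultiplicity_pow hQprime, hemul, hnot huQ,
      hnot (mt (hmemQ w).1 hw)] at heq
    generalize emultiplicity Q (Ideal.span {x₀ - algebraMap ℤ (𝓞 L) c}) = t at heq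
    induction t with
    | top =>
      norm_cast at heq
    | coe t =>
      norm_cast at heq
      omega
  obtain ⟨σ, hσ, hσ1⟩ := (Subgroup.bot_or_exists_ne_one _).resolve_left hinertia
  have hσroot : ∀ {x}, F'.IsRoot x → F'.IsRoot (σ • x) := fun {x} hx => by
    rw [hroot] at hx ⊢
    change aeval (σ.toRingHom (x : L)) F = 0
    rw [aeval_apply_int σ.toRingHom, hx, map_zero]
  have hσc : ∀ {x}, F'.IsRoot x → x - algebraMap ℤ (𝓞 L) c ∈ Q →
      σ • x - algebraMap ℤ (𝓞 L) c ∈ Q := fun {x} _ hxc => by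
    rw [← sub_add_sub_cancel _ x]
    exact Q.add_mem (hσ x) hxc
  have hmoved : ∀ {x}, F'.IsRoot x → σ • x ≠ x → x - algebraMap ℤ (𝓞 L) c ∈ Q :=
    fun {x} hx hne =>
      sub_mem_of_sub_mem_of_derivative_eq hF' hV' hx (hσroot hx) hne.symm (hσ x)
  obtain ⟨a, ha, hab⟩ : ∃ a, F'.IsRoot a ∧ σ • a ≠ a := by
    by_contra! hall
    refine hσ1 (hgen σ fun x hx => ?_)
    obtain ⟨y, rfl⟩ := hlift x hx
    exact congrArg (fun z : 𝓞 L => (z : L)) (hall y ((hroot y).2 hx))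
  have hac := hmoved ha hab
  have hb := hσroot ha
  have hbc := hσc ha hac
  have hmem : ∀ {x}, F'.IsRoot x → x - algebraMap ℤ (𝓞 L) c ∈ Q → x = a ∨ x = σ • a :=
    fun hx hxc => eq_or_eq_of_sub_mem_of_derivative_eq hF' hV' ha hb hx hab.symm hac hbc hxc
  have hσb : σ • σ • a = a :=
    (hmem (hσroot hb) (hσc hb hbc)).resolve_right fun h => hab (smul_left_cancel σ h)
  refine ⟨σ, a, (σ • a : 𝓞 L), fun h => hab (RingOfIntegers.ext h).symm, (hroot a).1 ha,
    (hroot _).1 hb, rfl, congrArg (fun z : 𝓞 L => (z : L)) hσb, fun x hx hxa hxb => ?_⟩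
  obtain ⟨y, rfl⟩ := hlift x hx
  by_contra hne
  have hy := (hroot y).2 hx
  rcases hmem hy (hmoved hy fun h => hne (congrArg (fun z : 𝓞 L => (z : L)) h)) with rfl | rfl
  · exact hxa rfl
  · exact hxb rfl
section polyIter

variable {R : Type*} [CommRing R]

theorem polyIter_add (φ : R[X]) (m n : ℕ) :
    polyIter φ (m + n) = (polyIter φ m).comp (polyIter φ n) := by
  induction m with
  | zero => simp [polyIter]
  | succ m ih => rw [Nat.succ_add, polyIter, ih, polyIter, comp_assoc]

theorem polyIter_one (φ : R[X]) : polyIter φ 1 = φ := by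
  simp [polyIter]

theorem aeval_polyIter_add {A : Type*} [CommRing A] [Algebra R A] (φ : R[X]) (m n : ℕ) (x : A) :
    aeval x (polyIter φ (m + n)) = aeval (aeval x (polyIter φ n)) (polyIter φ m) := by
  rw [polyIter_add, aeval_comp]

theorem natDegree_polyIter [NoZeroDivisors R] [Nontrivial R] (φ : R[X]) (n : ℕ) :
    (polyIter φ n).natDegree = φ.natDegree ^ n := by
  induction n with
  | zero => simp [polyIter]
  | succ n ih => rw [polyIter, natDegree_comp, ih, pow_succ']

theorem Polynomial.Monic.polyIter [NoZeroDivisors R] [Nontrivial R] {φ : R[X]} (h : φ.Monic)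
    (h0 : φ.natDegree ≠ 0) (n : ℕ) : (polyIter φ n).Monic := by
  induction n with
  | zero => exact monic_X
  | succ n ih =>
    refine Monic.comp h ih ?_
    rw [natDegree_polyIter]
    exact pow_ne_zero _ h0

theorem map_polyIter {S : Type*} [CommRing S] (f : R →+* S) (φ : R[X]) (n : ℕ) :
    (polyIter φ n).map f = polyIter (φ.map f) n := by
  induction n with
  | zero => simp [polyIter]
  | succ n ih => rw [polyIter, polyIter, Polynomial.map_comp, ih]

theorem polyIter_X_pow (p n : ℕ) : polyIter (X ^ p : R[X]) n = X ^ p ^ n := by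
  induction n with
  | zero => simp [polyIter]
  | succ n ih => rw [polyIter, ih, pow_comp, X_comp, ← pow_mul, pow_succ]

end polyIter

section trinomial

/-- The trinomial `x^p + kp x^(p-1) - kp`. -/
noncomputable def oddTrinomial (p k : ℕ) : ℤ[X] :=
  X ^ p + C ((k : ℤ) * p) * X ^ (p - 1) - C ((k : ℤ) * p)

variable {p k : ℕ}

theorem natDegree_oddTrinomial (hp : 2 ≤ p) : (oddTrinomial p k).natDegree = p := by
  obtain ⟨r, rfl⟩ := Nat.exists_eq_add_of_le' hp
  rw [oddTrinomial, show r + 2 - 1 = r + 1 from rfl]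
  compute_degree!

theorem monic_oddTrinomial (hp : 2 ≤ p) : (oddTrinomial p k).Monic := by
  obtain ⟨r, rfl⟩ := Nat.exists_eq_add_of_le' hp
  rw [oddTrinomial, show r + 2 - 1 = r + 1 from rfl]
  monicity!

theorem aeval_oddTrinomial {A : Type*} [CommRing A] (x : A) :
    aeval x (oddTrinomial p k) = x ^ p + k * p * x ^ (p - 1) - k * p := by
  simp [oddTrinomial]

theorem aeval_zero_polyIter_oddTrinomial {A : Type*} [CommRing A] (hp : 2 ≤ p) (n : ℕ) :
    aeval (0 : A) (polyIter (oddTrinomial p k) (n + 1)) = -(k * p) := by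
  obtain ⟨r, rfl⟩ := Nat.exists_eq_add_of_le' hp
  induction n with
  | zero => simp [polyIter_one, aeval_oddTrinomial]
  | succ n ih =>
    rw [polyIter, aeval_comp, ih, aeval_oddTrinomial, show r + 2 - 1 = r + 1 from rfl]
    ring

theorem irreducible_polyIter_oddTrinomial (hp : p.Prime) (hpk : ¬ p ∣ k) (n : ℕ) :
    Irreducible (polyIter (oddTrinomial p k) n) := by
  have hmon := (monic_oddTrinomial (k := k) hp.two_le).polyIter
    (by rw [natDegree_oddTrinomial hp.two_le]; exact hp.ne_zero)
  rcases n with - | n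
  · exact irreducible_X
  have hdeg : (polyIter (oddTrinomial p k) (n + 1)).natDegree = p ^ (n + 1) := by
    rw [natDegree_polyIter, natDegree_oddTrinomial hp.two_le]
  have hpp : Prime (p : ℤ) := Nat.prime_iff_prime_int.1 hp
  have hP := (Ideal.span_singleton_prime hpp.ne_zero).2 hpp
  refine IsEisensteinAt.irreducible (𝓟 := Ideal.span {(p : ℤ)}) ⟨?_, fun {m} hm => ?_, ?_⟩ hP
    (hmon _).isPrimitive (by rw [hdeg]; exact pow_pos hp.pos _)
  · rw [(hmon _).leadingCoeff]
    exact fun h => hP.ne_top ((Ideal.eq_top_iff_one _).2 h)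
  · rw [hdeg] at hm
    have hmap : (polyIter (oddTrinomial p k) (n + 1)).map (Int.castRingHom (ZMod p)) =
        X ^ p ^ (n + 1) := by
      rw [map_polyIter, oddTrinomial]
      simp [polyIter_X_pow]
    have := congrArg (coeff · m) hmap
    simp only [coeff_map, coeff_X_pow, hm.ne, if_false] at this
    rwa [Ideal.mem_span_singleton, ← ZMod.intCast_zmod_eq_zero_iff_dvd]
  · rw [coeff_zero_eq_eval_zero, ← coe_aeval_eq_eval, aeval_zero_polyIter_oddTrinomial hp.two_le,
      Ideal.span_singleton_pow, Ideal.mem_span_singleton, dvd_neg, pow_two,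
      Int.mul_dvd_mul_iff_right hpp.ne_zero]
    exact_mod_cast hpk

theorem derivative_oddTrinomial (hp : 2 ≤ p) : derivative (oddTrinomial p k) =
    (X - C (-((k : ℤ) * (p - 1)))) * (C (p : ℤ) * X ^ (p - 2)) := by
  obtain ⟨r, rfl⟩ := Nat.exists_eq_add_of_le' hp
  rw [oddTrinomial, show r + 2 - 1 = r + 1 from rfl]
  simp
  ring

/-- The derivative of an iterate of the trinomial vanishes to first order at the nonzero critical
point `c`, and its other zeros are preimages of the critical points. -/
theorem exists_derivative_polyIter_oddTrinomial_eq (hp : 2 ≤ p) (n : ℕ) :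
    ∃ V : ℤ[X], derivative (polyIter (oddTrinomial p k) (n + 1)) =
        (X - C (-((k : ℤ) * (p - 1)))) * V ∧
      ∀ (K : Type) [Field K] (x : K), aeval x V = 0 → (p : K) = 0 ∨
        ∃ i ≤ n, aeval x (polyIter (oddTrinomial p k) i) = 0 ∨
          (1 ≤ i ∧ aeval x (polyIter (oddTrinomial p k) i) = ((-((k : ℤ) * (p - 1)) : ℤ) : K)) := by
  induction n with
  | zero =>
    refine ⟨C (p : ℤ) * X ^ (p - 2), ?_, fun K _ x hx => ?_⟩
    · rw [polyIter_one, derivative_oddTrinomial hp]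
    · simp only [map_mul, map_pow, aeval_X, aeval_C, mul_eq_zero] at hx
      refine hx.imp (fun h => by simpa using h) fun h => ⟨0, le_rfl, Or.inl ?_⟩
      simpa [polyIter] using eq_zero_of_pow_eq_zero h
  | succ n ih =>
    obtain ⟨V, hV, hVx⟩ := ih
    refine ⟨V * (derivative (oddTrinomial p k)).comp (polyIter (oddTrinomial p k) (n + 1)), ?_,
      fun K _ x hx => ?_⟩
    · rw [polyIter, derivative_comp, hV, mul_assoc]
    · rw [map_mul, mul_eq_zero] at hx
      rcases hx with hx | hx
      · exact (hVx K x hx).imp_right fun ⟨i, hi, h⟩ => ⟨i, hi.trans n.le_succ, h⟩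
      rw [aeval_comp, derivative_oddTrinomial hp] at hx
      simp only [map_mul, map_pow, map_sub, aeval_X, aeval_C, mul_eq_zero, sub_eq_zero] at hx
      rcases hx with hx | hx | hx
      · exact Or.inr ⟨n + 1, le_rfl, Or.inr ⟨by omega, by simpa using hx⟩⟩
      · exact Or.inl (by simpa using hx)
      · exact Or.inr ⟨n + 1, le_rfl, Or.inl (eq_zero_of_pow_eq_zero hx)⟩

end trinomial

section criticalOrbit

variable {p k : ℕ}

/-- The orbit of the nonzero critical point of the trinomial consists of the numbers `k b` with `b`
positive, prime to `p` and `k`, and not a square. -/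
theorem exists_aeval_polyIter_oddTrinomial_eq_mul (hp : p.Prime) (hk : 0 < k) (hpk : ¬ p ∣ k)
    (hcase : (5 ≤ p ∧ k % 3 = 1) ∨ (p = 3 ∧ k = 2)) (n : ℕ) :
    ∃ b : ℤ, aeval (-((k : ℤ) * (p - 1))) (polyIter (oddTrinomial p k) (n + 1)) = k * b ∧
      0 < b ∧ ¬ (p : ℤ) ∣ b ∧ (∃ t, b = k * t - p) ∧ ¬ IsSquare b := by
  have hpp : Prime (p : ℤ) := Nat.prime_iff_prime_int.1 hp
  have hp3 : 3 ≤ p := by omega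
  have hpk' : ¬ (p : ℤ) ∣ k := by exact_mod_cast hpk
  obtain ⟨s, hs⟩ := hp.odd_of_ne_two (by omega)
  have hs1 : p - 1 = 2 * s := by omega
  suffices ∃ b : ℤ, aeval (-((k : ℤ) * (p - 1))) (polyIter (oddTrinomial p k) (n + 1)) = k * b ∧
      0 < b ∧ ¬ (p : ℤ) ∣ b ∧ (∃ t, b = k * t - p) ∧
      ((5 ≤ p ∧ k % 3 = 1 ∧ (b : ZMod 3) = 2) ∨ (p = 3 ∧ k = 2 ∧ (b : ZMod 5) = 3)) by
    obtain ⟨b, h1, h2, h3, h4, h5⟩ := this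
    refine ⟨b, h1, h2, h3, h4, ?_⟩
    rintro ⟨r, rfl⟩
    rcases h5 with ⟨-, -, h⟩ | ⟨-, -, h⟩
    · rw [Int.cast_mul] at h
      generalize (r : ZMod 3) = r at h
      revert r
      decide
    · rw [Int.cast_mul] at h
      generalize (r : ZMod 5) = r at h
      revert r
      decide
  have hk3 : k % 3 = 1 → (k : ZMod 3) = 1 := fun h => by
    rw [← ZMod.natCast_mod, h, Nat.cast_one]
  have hp3' : 5 ≤ p → (p : ZMod 3) = 1 ∨ (p : ZMod 3) = 2 := fun h => by
    have h0 : (p : ZMod 3) ≠ 0 := fun h0 => by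
      rw [ZMod.natCast_eq_zero_iff, Nat.prime_dvd_prime_iff_eq Nat.prime_three hp] at h0
      omega
    generalize (p : ZMod 3) = r at h0
    revert r
    decide
  induction n with
  | zero =>
    refine ⟨k ^ (2 * s) * (p - 1) ^ (2 * s) - p, ?_, ?_, ?_, ?_, ?_⟩
    · have h1 : (-((k : ℤ) * (p - 1))) ^ (2 * s) = k ^ (2 * s) * (p - 1) ^ (2 * s) := by
        rw [(even_two_mul s).neg_pow, mul_pow]
      have h2 : (-((k : ℤ) * (p - 1))) ^ p = (-((k : ℤ) * (p - 1))) ^ (2 * s) * -(k * (p - 1)) := by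
        rw [← pow_succ, ← hs]
      rw [polyIter_one, aeval_oddTrinomial, hs1, h2, h1]
      ring
    · have h1 : (1 : ℤ) ≤ k ^ (2 * s) := one_le_pow₀ (by exact_mod_cast hk)
      have h2 : ((p : ℤ) - 1) ^ 2 ≤ (p - 1) ^ (2 * s) :=
        pow_le_pow_right₀ (by omega) (by omega)
      have h3 : (3 : ℤ) ≤ p := by exact_mod_cast hp3
      nlinarith
    · rw [dvd_sub_self_right]
      intro h
      rcases hpp.dvd_or_dvd h with h | h
      · exact hpk' (hpp.dvd_of_dvd_pow h)
      · have := hpp.dvd_of_dvd_pow h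
        rw [dvd_sub_right dvd_rfl] at this
        exact hpp.not_dvd_one this
    · exact ⟨k ^ (2 * s - 1) * (p - 1) ^ (2 * s), by
        rw [← mul_assoc, mul_pow_sub_one (by omega)]⟩
    · rcases hcase with ⟨h5, hk1⟩ | ⟨rfl, rfl⟩
      · refine Or.inl ⟨h5, hk1, ?_⟩
        push_cast
        rw [hk3 hk1]
        rcases hp3' h5 with h | h <;> rw [h]
        · rw [sub_self, zero_pow (by omega), mul_zero]
          decide
        · rw [show (2 : ZMod 3) - 1 = 1 by decide, one_pow]
          decide
      · obtain rfl : s = 1 := by omega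
        refine Or.inr ⟨rfl, rfl, ?_⟩
        decide
  | succ n ih =>
    obtain ⟨b, h1, h2, h3, h4, h5⟩ := ih
    refine ⟨k ^ (2 * s) * b ^ (2 * s) * (b + p) - p, ?_, ?_, ?_, ?_, ?_⟩
    · rw [polyIter, aeval_comp, h1, aeval_oddTrinomial, hs1, hs, pow_succ, mul_pow]
      push_cast
      ring
    · have h6 : (1 : ℤ) ≤ k ^ (2 * s) := one_le_pow₀ (by exact_mod_cast hk)
      have h7 : (1 : ℤ) ≤ b ^ (2 * s) := one_le_pow₀ h2
      have h8 := one_le_mul_of_one_le_of_one_le h6 h7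
      nlinarith
    · rw [dvd_sub_self_right]
      intro h
      rcases hpp.dvd_or_dvd h with h | h
      · rcases hpp.dvd_or_dvd h with h | h
        · exact hpk' (hpp.dvd_of_dvd_pow h)
        · exact h3 (hpp.dvd_of_dvd_pow h)
      · exact h3 ((dvd_add_left dvd_rfl).1 h)
    · exact ⟨k ^ (2 * s - 1) * (b ^ (2 * s) * (b + p)), by
        rw [← mul_assoc, mul_pow_sub_one (by omega)]
        ring⟩
    · rcases h5 with ⟨h5, hk1, hb⟩ | ⟨rfl, rfl, hb⟩
      · refine Or.inl ⟨h5, hk1, ?_⟩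
        push_cast
        rw [hk3 hk1, hb, pow_mul 2, show (2 : ZMod 3) ^ 2 = 1 by decide]
        ring
      · obtain rfl : s = 1 := by omega
        refine Or.inr ⟨rfl, rfl, ?_⟩
        push_cast
        rw [hb]
        decide

end criticalOrbit

theorem Nat.exists_eq_prime_pow_odd_mul_of_not_isSquare {b : ℕ} (hb : 0 < b) (h : ¬ IsSquare b) :
    ∃ q m w : ℕ, q.Prime ∧ b = q ^ (2 * m + 1) * w ∧ ¬ q ∣ w := by
  obtain ⟨a, r, ha, hr, rfl, hsf⟩ := Nat.sq_mul_squarefree_of_pos hb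
  have ha1 : a ≠ 1 := fun h1 => h ⟨r, by rw [h1]; ring⟩
  obtain ⟨q, hq, t, rfl⟩ := Nat.exists_prime_and_dvd ha1
  have ht : ¬ q ∣ t := fun ⟨u, hu⟩ => hq.one_lt.ne' (Nat.isUnit_iff.1 (hsf q ⟨u, by rw [hu]; ring⟩))
  obtain ⟨m, w, hw, rfl⟩ := Nat.exists_eq_pow_mul_and_not_dvd hr.ne' q hq.ne_one
  refine ⟨q, m, w ^ 2 * t, hq, by ring, fun hd => ?_⟩
  rcases hq.dvd_mul.1 hd with hd | hd
  · exact hw (hq.dvd_of_dvd_pow hd)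
  · exact ht hd

section swap

variable {p k : ℕ}

theorem exists_prime_pow_odd_mul_eq_aeval_polyIter_oddTrinomial (hp : p.Prime) (hk : 0 < k)
    (hpk : ¬ p ∣ k) (hcase : (5 ≤ p ∧ k % 3 = 1) ∨ (p = 3 ∧ k = 2)) (n : ℕ) :
    ∃ (q m : ℕ) (w : ℤ), q.Prime ∧ ¬ q ∣ k ∧ ¬ q ∣ p ∧ ¬ (q : ℤ) ∣ w ∧
      aeval (-((k : ℤ) * (p - 1))) (polyIter (oddTrinomial p k) (n + 1)) =
        (q : ℤ) ^ (2 * m + 1) * w := by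
  obtain ⟨b, hb, hb0, hpb, ⟨t, ht⟩, hsq⟩ :=
    exists_aeval_polyIter_oddTrinomial_eq_mul hp hk hpk hcase n
  lift b to ℕ using hb0.le
  obtain ⟨q, m, w, hq, rfl, hw⟩ := Nat.exists_eq_prime_pow_odd_mul_of_not_isSquare
    (b := b) (by exact_mod_cast hb0) fun ⟨r, hr⟩ => hsq ⟨r, by exact_mod_cast hr⟩
  have hqb : (q : ℤ) ∣ (q ^ (2 * m + 1) * w : ℕ) := by
    exact_mod_cast Dvd.dvd.mul_right (dvd_pow_self q (by omega)) _
  have hqp : ¬ q ∣ p := fun h => by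
    rw [(Nat.prime_dvd_prime_iff_eq hq hp).1 h] at hqb hpb
    exact hpb hqb
  have hqk : ¬ q ∣ k := fun h => by
    refine hqp ?_
    rw [ht, dvd_sub_right (Dvd.dvd.mul_right (by exact_mod_cast h) t)] at hqb
    exact_mod_cast hqb
  refine ⟨q, m, w * k, hq, hqk, hqp, fun h => ?_, ?_⟩
  · have h' : q ∣ w * k := by exact_mod_cast h
    exact (hq.dvd_mul.1 h').elim hw hqk
  · rw [hb]
    push_cast
    ring

/-- Some automorphism of a splitting field of an iterate of the trinomial swaps two roots and fixes
all others. -/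
theorem exists_swap_polyIter_oddTrinomial (hp : p.Prime) (hk : 0 < k) (hpk : ¬ p ∣ k)
    (hcase : (5 ≤ p ∧ k % 3 = 1) ∨ (p = 3 ∧ k = 2)) (n : ℕ) (L : Type) [Field L] [Algebra ℚ L]
    [FiniteDimensional ℚ L] [IsGalois ℚ L] {F : ℤ[X]}
    (hF : F = polyIter (oddTrinomial p k) (n + 1))
    (hsplits : (F.map (algebraMap ℤ L)).Splits)
    (hgen : ∀ σ : L ≃ₐ[ℚ] L, (∀ x, aeval x F = 0 → σ x = x) → σ = 1) :
    ∃ (σ : L ≃ₐ[ℚ] L) (a b : L), a ≠ b ∧ aeval a F = 0 ∧ aeval b F = 0 ∧ σ a = b ∧ σ b = a ∧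
      ∀ x, aeval x F = 0 → x ≠ a → x ≠ b → σ x = x := by
  have hmonic : F.Monic := hF ▸ (monic_oddTrinomial hp.two_le).polyIter
    (by rw [natDegree_oddTrinomial hp.two_le]; exact hp.ne_zero) _
  obtain ⟨q, m, w, hq, hqk, hqp, hqw, hw⟩ :=
    exists_prime_pow_odd_mul_eq_aeval_polyIter_oddTrinomial hp hk hpk hcase n
  obtain ⟨V, hV, hVx⟩ := exists_derivative_polyIter_oddTrinomial_eq (k := k) hp.two_le n
  have : CharZero L := algebraRat.charZero L
  have halg : ‹Algebra ℚ L› = DivisionRing.toRatAlgebra := Subsingleton.elim _ _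
  subst halg
  have : NumberField L := ⟨⟩
  refine NumberField.exists_swap_of_derivative_eq L hmonic hsplits hgen (hF ▸ hV) hq
    (fun K _ _ x hx hVx0 => ?_) (w := w) (by rw [← hw, hF, coe_aeval_eq_eval]) hqw
  subst hF
  have hcast : ∀ a : ℕ, (a : K) = 0 ↔ q ∣ a := CharP.cast_eq_zero_iff K q
  have hkp : ¬ -((k : K) * p) = 0 := by
    rw [neg_eq_zero, mul_eq_zero, hcast, hcast]
    tauto
  rcases hVx K x hVx0 with h | ⟨i, hi, h | ⟨hi1, h⟩⟩
  · exact hqp ((hcast p).1 h)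
  · obtain ⟨j, rfl⟩ := Nat.exists_eq_add_of_le' hi
    rw [add_right_comm, aeval_polyIter_add, h, aeval_zero_polyIter_oddTrinomial hp.two_le] at hx
    exact hkp hx
  · obtain ⟨j, rfl⟩ := Nat.exists_eq_add_of_le' hi
    obtain ⟨l, rfl⟩ := Nat.exists_eq_add_of_le' hi1
    have h0 : aeval ((-((k : ℤ) * (p - 1)) : ℤ) : K)
        (polyIter (oddTrinomial p k) (j + (l + 1) + 1)) = 0 := by
      rw [← eq_intCast (algebraMap ℤ K), aeval_algebraMap_apply, hw, map_mul, map_pow]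
      simp
    rw [add_right_comm, aeval_polyIter_add, h] at hx
    rw [show j + (l + 1) + 1 = (l + 1) + (j + 1) by ring, aeval_polyIter_add, hx,
      aeval_zero_polyIter_oddTrinomial hp.two_le] at h0
    exact hkp h0

end swap

theorem IntermediateField.apply_eq_of_mem_adjoin {K E : Type*} [Field K] [Field E] [Algebra K E]
    {L : IntermediateField K E} {S : Set E} (hS : IntermediateField.adjoin K S ≤ L)
    (σ : L ≃ₐ[K] L) (h : ∀ x : L, (x : E) ∈ S → σ x = x) {x : E}
    (hx : x ∈ IntermediateField.adjoin K S) (hxL : x ∈ L) : σ ⟨x, hxL⟩ = ⟨x, hxL⟩ := by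
  induction hx using IntermediateField.adjoin_induction with
  | mem x hx => exact h ⟨x, hxL⟩ hx
  | algebraMap x => exact σ.commutes x
  | add x y hx hy ihx ihy =>
    rw [← AddMemClass.mk_add_mk L x y (hS hx) (hS hy), map_add, ihx, ihy]
  | inv x hx ih =>
    exact (map_inv₀ σ (⟨x, hS hx⟩ : L)).trans (congrArg _ (ih (hS hx)))
  | mul x y hx hy ihx ihy =>
    rw [← MulMemClass.mk_mul_mk L x y (hS hx) (hS hy), map_mul, ihx, ihy]

section irreducible

variable {L : Type*} [Field L] [Algebra ℚ L] {P : ℤ[X]}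

theorem Polynomial.rootSet_map_int_rat [Algebra ℤ L] (P : ℤ[X]) :
    (P.map (algebraMap ℤ ℚ)).rootSet L = P.rootSet L := by
  classical
  rw [rootSet_def, rootSet_def, aroots_def, aroots_def, Polynomial.map_map,
    RingHom.ext_int (RingHom.comp _ _) (algebraMap ℤ L)]

theorem Polynomial.Monic.irreducible_map_int_rat (hP : P.Monic) (hirr : Irreducible P) :
    Irreducible (P.map (algebraMap ℤ ℚ)) :=
  (hP.irreducible_iff_irreducible_map_fraction_map).1 hirr

theorem Polynomial.Monic.card_rootSet_of_irreducible (hP : P.Monic) (hirr : Irreducible P)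
    (hsplits : (P.map (algebraMap ℤ L)).Splits) : Nat.card (P.rootSet L) = P.natDegree := by
  rw [← rootSet_map_int_rat, Nat.card_eq_fintype_card, card_rootSet_eq_natDegree
    (hP.irreducible_map_int_rat hirr).separable, hP.natDegree_map]
  rwa [Polynomial.map_map, ← IsScalarTower.algebraMap_eq]

theorem Polynomial.Monic.exists_algEquiv_apply_eq_of_irreducible [Normal ℚ L] (hP : P.Monic)
    (hirr : Irreducible P) {x y : L} (hx : aeval x P = 0) (hy : aeval y P = 0) :
    ∃ σ : L ≃ₐ[ℚ] L, σ x = y := by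
  have key : ∀ {z : L}, aeval z P = 0 → P.map (algebraMap ℤ ℚ) = minpoly ℚ z := fun hz =>
    minpoly.eq_of_irreducible_of_monic (hP.irreducible_map_int_rat hirr)
      (by rwa [aeval_map_algebraMap]) (hP.map _)
  exact (Normal.minpoly_eq_iff_mem_orbit L).1 ((key hy).symm.trans (key hx))

theorem Polynomial.card_rootSet_le_natDegree {R : Type*} [CommRing R] [IsDomain R] (P : ℤ[X])
    [Algebra ℤ R] : Nat.card (P.rootSet R) ≤ P.natDegree := by
  classical
  rw [Nat.card_coe_set_eq, rootSet_def, Set.ncard_coe_finset]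
  exact (Multiset.toFinset_card_le _).trans ((card_roots' _).trans natDegree_map_le)

end irreducible

/-- Let `P` and `φ` be monic integer polynomials with `φ` of odd prime degree `p` and `P ∘ φ`
irreducible. If `L` is a Galois field generated by the roots of `P ∘ φ` and some automorphism of
`L` acts as a transposition on these roots, then the group of automorphisms fixing the roots of `P`
is as large as possible. -/
theorem Polynomial.card_algEquiv_fixing_roots {L : Type*} [Field L] [Algebra ℚ L] [Normal ℚ L]
    {P φ : ℤ[X]} {p : ℕ} (hp : p.Prime) (hp3 : 3 ≤ p) (hφ : φ.Monic) (hdeg : φ.natDegree = p)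
    (hP : P.Monic) (hirr : Irreducible (P.comp φ))
    (hsplits : ((P.comp φ).map (algebraMap ℤ L)).Splits)
    (hgen : ∀ σ : L ≃ₐ[ℚ] L, (∀ x, aeval x (P.comp φ) = 0 → σ x = x) → σ = 1)
    (hswap : ∃ (σ : L ≃ₐ[ℚ] L) (a b : L), a ≠ b ∧ aeval a (P.comp φ) = 0 ∧
      aeval b (P.comp φ) = 0 ∧ σ a = b ∧ σ b = a ∧
      ∀ x, aeval x (P.comp φ) = 0 → x ≠ a → x ≠ b → σ x = x) :
    Nat.card {σ : L ≃ₐ[ℚ] L // ∀ x, aeval x P = 0 → σ x = x} = p.factorial ^ P.natDegree := by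
  classical
  have : CharZero L := algebraRat.charZero L
  have hF : (P.comp φ).Monic := hP.comp hφ (hdeg ▸ hp.ne_zero)
  have hmemF : ∀ {x : L}, x ∈ (P.comp φ).rootSet L ↔ aeval x (P.comp φ) = 0 := by
    simp [mem_rootSet, hF.ne_zero]
  have hmemP : ∀ {x : L}, x ∈ P.rootSet L ↔ aeval x P = 0 := by
    simp [mem_rootSet, hP.ne_zero]
  let f : (P.comp φ).rootSet L → P.rootSet L := fun x => ⟨aeval (x : L) φ, by
    rw [hmemP, ← aeval_comp]
    exact hmemF.1 x.2⟩
  have hfib_le : ∀ y, Fintype.card {x // f x = y} ≤ p := fun y => by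
    have hQ : (φ.map (algebraMap ℤ L) - C (y : L)).natDegree = p := by
      rw [natDegree_sub_C, hφ.natDegree_map, hdeg]
    have hQ0 : φ.map (algebraMap ℤ L) - C (y : L) ≠ 0 := fun h => by
      rw [h, natDegree_zero] at hQ
      exact hp.ne_zero hQ.symm
    rw [← hQ]
    refine le_trans ?_ ((Multiset.toFinset_card_le _).trans (card_roots' _))
    rw [← Fintype.card_coe]
    refine Fintype.card_le_of_injective (fun x => ⟨(x.1 : L), ?_⟩) fun x y h => ?_
    · rw [Multiset.mem_toFinset, mem_roots hQ0, IsRoot, eval_sub, eval_C, eval_map_algebraMap,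
        sub_eq_zero]
      exact congrArg Subtype.val x.2
    · simp only [Subtype.mk.injEq] at h
      exact Subtype.ext (Subtype.ext h)
  have hsum : ∑ y, Fintype.card {x // f x = y} = P.natDegree * p := by
    rw [← Fintype.card_sigma, Fintype.card_congr (Equiv.sigmaFiberEquiv f),
      ← Nat.card_eq_fintype_card, hF.card_rootSet_of_irreducible hirr hsplits, natDegree_comp, hdeg]
  have hsum_le : ∑ y, Fintype.card {x // f x = y} ≤ ∑ y : P.rootSet L, p :=
    Finset.sum_le_sum fun y _ => hfib_le y
  have hcardP : Fintype.card (P.rootSet L) = P.natDegree := by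
    refine le_antisymm (Nat.card_eq_fintype_card (α := P.rootSet L) ▸ card_rootSet_le_natDegree P) ?_
    rw [hsum, Finset.sum_const, Finset.card_univ, smul_eq_mul] at hsum_le
    exact Nat.le_of_mul_le_mul_right hsum_le hp.pos
  have hfib : ∀ y, Fintype.card {x // f x = y} = p := fun y =>
    (Finset.sum_eq_sum_iff_of_le fun y _ => hfib_le y).1
      (by rw [hsum, Finset.sum_const, Finset.card_univ, smul_eq_mul, hcardP]) y (Finset.mem_univ _)
  let ρ := MulAction.toPermHom (L ≃ₐ[ℚ] L) ((P.comp φ).rootSet L)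
  have hρ : ∀ σ x, ((ρ σ x : (P.comp φ).rootSet L) : L) = σ x := fun σ x => rootSet.coe_smul σ x
  have hfρ : ∀ σ x, (f (ρ σ x) : L) = σ (f x : L) := fun σ x => by
    change aeval (ρ σ x : L) φ = _
    rw [hρ]
    exact aeval_apply_int (σ : L →+* L) x φ
  have hρ_inj : Function.Injective ρ := by
    refine (injective_iff_map_eq_one ρ).2 fun σ hσ => hgen σ fun x hx => ?_
    rw [← hρ σ ⟨x, hmemF.2 hx⟩, hσ, Equiv.Perm.one_apply]
  have hfix : ∀ σ : L ≃ₐ[ℚ] L, (∀ x, aeval x P = 0 → σ x = x) ↔ f ∘ ρ σ = f := by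
    refine fun σ => ⟨fun h => _root_.funext fun x => Subtype.ext ?_, fun h x hx => ?_⟩
    · rw [Function.comp_apply, hfρ]
      exact h _ (hmemP.1 (f x).2)
    · obtain ⟨⟨y, hy⟩⟩ := Fintype.card_pos_iff.1 ((hfib ⟨x, hmemP.2 hx⟩).symm ▸ hp.pos)
      have := congrArg Subtype.val (congrFun h y)
      rwa [Function.comp_apply, hfρ, hy] at this
  have hmax : ∀ g : Equiv.Perm ((P.comp φ).rootSet L), f ∘ g = f → g ∈ ρ.range := by
    refine fun g hg => Subgroup.mem_of_comp_eq_of_isSwap f ρ.range hp hp3 (fun x => ?_)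
      (fun x y => ?_) ?_ ?_ g (congrFun hg)
    · rw [← Fintype.card_subtype]
      exact hfib (f x)
    · obtain ⟨σ, hσ⟩ := hF.exists_algEquiv_apply_eq_of_irreducible hirr (hmemF.1 x.2) (hmemF.1 y.2)
      exact ⟨ρ σ, ⟨σ, rfl⟩, Subtype.ext ((hρ σ x).trans hσ)⟩
    · rintro _ ⟨σ, rfl⟩ x y hxy
      exact Subtype.ext (by rw [hfρ, hfρ, hxy])
    · obtain ⟨σ, a, b, hab, ha, hb, hσa, hσb, hσ⟩ := hswap
      refine ⟨⟨a, hmemF.2 ha⟩, ⟨b, hmemF.2 hb⟩, fun h => hab (congrArg Subtype.val h), σ, ?_⟩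
      refine Equiv.ext fun x => Subtype.ext ?_
      rw [hρ]
      rcases eq_or_ne (x : L) a with hxa | hxa
      · rw [hxa, hσa, show x = ⟨a, hmemF.2 ha⟩ from Subtype.ext hxa, Equiv.swap_apply_left]
      rcases eq_or_ne (x : L) b with hxb | hxb
      · rw [hxb, hσb, show x = ⟨b, hmemF.2 hb⟩ from Subtype.ext hxb, Equiv.swap_apply_right]
      rw [hσ x (hmemF.1 x.2) hxa hxb, Equiv.swap_apply_of_ne_of_ne]
      · exact fun h => hxa (congrArg Subtype.val h)
      · exact fun h => hxb (congrArg Subtype.val h)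
  calc Nat.card {σ : L ≃ₐ[ℚ] L // ∀ x, aeval x P = 0 → σ x = x}
      = Nat.card {g : Equiv.Perm ((P.comp φ).rootSet L) // f ∘ g = f} := by
        refine Nat.card_congr (Equiv.ofBijective (fun σ => ⟨ρ σ.1, (hfix σ.1).1 σ.2⟩)
          ⟨fun σ τ h => Subtype.ext (hρ_inj (congrArg Subtype.val h)), fun ⟨g, hg⟩ => ?_⟩)
        obtain ⟨σ, rfl⟩ := hmax g hg
        exact ⟨⟨σ, (hfix σ).2 hg⟩, rfl⟩
    _ = p.factorial ^ P.natDegree := by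
        rw [Nat.card_eq_fintype_card, DomMulAct.stabilizer_card]
        simp only [hfib, Finset.prod_const, Finset.card_univ, hcardP]

section Kfield

variable {φ : ℤ[X]}

theorem mem_Kfield_of_aeval_eq_zero {n : ℕ} (h0 : polyIter φ n ≠ 0) {x : AlgebraicClosure ℚ}
    (hx : aeval x (polyIter φ n) = 0) : x ∈ Kfield φ n :=
  IntermediateField.subset_adjoin _ _ (mem_rootSet.2 ⟨h0, hx⟩)

instance isSplittingField_Kfield (n : ℕ) :
    IsSplittingField ℚ (Kfield φ n) ((polyIter φ n).map (algebraMap ℤ ℚ)) := by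
  rw [Kfield, ← rootSet_map_int_rat]
  exact IntermediateField.adjoin_rootSet_isSplittingField (IsAlgClosed.splits _)

instance finiteDimensional_Kfield (n : ℕ) : FiniteDimensional ℚ (Kfield φ n) :=
  IsSplittingField.finiteDimensional _ ((polyIter φ n).map (algebraMap ℤ ℚ))

instance isGalois_Kfield (n : ℕ) : IsGalois ℚ (Kfield φ n) :=
  have := Normal.of_isSplittingField (E := Kfield φ n) ((polyIter φ n).map (algebraMap ℤ ℚ))
  { }

theorem exists_aeval_int_eq {E : Type*} [Field E] [IsAlgClosed E] [Algebra ℤ E] (hφ : φ.Monic)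
    (hdeg : φ.natDegree ≠ 0) (x : E) : ∃ y : E, aeval y φ = x := by
  obtain ⟨y, hy⟩ := IsAlgClosed.exists_root (φ.map (algebraMap ℤ E) - C x) fun h => hdeg (by
    rw [← hφ.natDegree_map (algebraMap ℤ E), ← natDegree_sub_C (a := x),
      natDegree_eq_zero_iff_degree_le_zero.2 h.le])
  refine ⟨y, ?_⟩
  rwa [IsRoot, eval_sub, eval_C, eval_map_algebraMap, sub_eq_zero] at hy

theorem Kfield_le_Kfield_succ (hφ : φ.Monic) (hdeg : φ.natDegree ≠ 0) (n : ℕ) :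
    Kfield φ n ≤ Kfield φ (n + 1) := by
  refine IntermediateField.adjoin_le_iff.2 fun x hx => ?_
  obtain ⟨y, rfl⟩ := exists_aeval_int_eq hφ hdeg x
  have hy := mem_Kfield_of_aeval_eq_zero (n := n + 1) (hφ.polyIter hdeg _).ne_zero (x := y) (by
    rw [aeval_polyIter_add, polyIter_one]
    exact (mem_rootSet.1 hx).2)
  have := aeval_apply_int (algebraMap (Kfield φ (n + 1)) (AlgebraicClosure ℚ)) ⟨y, hy⟩ φ
  exact this ▸ SetLike.coe_mem _

theorem forall_mem_Kfield_iff {m n : ℕ} (h0 : polyIter φ m ≠ 0) (hle : Kfield φ m ≤ Kfield φ n)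
    (σ : Kfield φ n ≃ₐ[ℚ] Kfield φ n) [Algebra ℤ (Kfield φ n)] :
    (∀ (x : AlgebraicClosure ℚ) (_ : x ∈ Kfield φ m) (hx' : x ∈ Kfield φ n),
      σ ⟨x, hx'⟩ = ⟨x, hx'⟩) ↔ ∀ x : Kfield φ n, aeval x (polyIter φ m) = 0 → σ x = x := by
  have key : ∀ x : Kfield φ n, aeval x (polyIter φ m) = 0 ↔
      (x : AlgebraicClosure ℚ) ∈ (polyIter φ m).rootSet (AlgebraicClosure ℚ) := fun x => by
    have := aeval_apply_int (algebraMap (Kfield φ n) (AlgebraicClosure ℚ)) x (polyIter φ m)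
    rw [mem_rootSet, and_iff_right h0, ← map_eq_zero (algebraMap (Kfield φ n) (AlgebraicClosure ℚ)),
      ← this]
    rfl
  refine ⟨fun h x hx => h x (IntermediateField.subset_adjoin _ _ ((key x).1 hx)) x.2,
    fun h x hx hx' => ?_⟩
  exact IntermediateField.apply_eq_of_mem_adjoin hle σ (fun x hx => h x ((key x).2 hx)) hx hx'

end Kfield

theorem relGalCard_oddTrinomial {p k : ℕ} (hp : p.Prime) (hk : 0 < k) (hpk : ¬ p ∣ k)
    (hcase : (5 ≤ p ∧ k % 3 = 1) ∨ (p = 3 ∧ k = 2)) (n : ℕ) :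
    relGalCard (oddTrinomial p k) (n + 1) = p.factorial ^ p ^ n := by
  have hdeg := natDegree_oddTrinomial (k := k) hp.two_le
  have hdeg0 : (oddTrinomial p k).natDegree ≠ 0 := by
    rw [hdeg]
    exact hp.ne_zero
  have hφ := monic_oddTrinomial (k := k) hp.two_le
  have hmonic := hφ.polyIter hdeg0
  set φ := oddTrinomial p k
  have hF : polyIter φ (n + 1) = (polyIter φ n).comp φ := by
    rw [polyIter_add, polyIter_one]
  have hsplits : ((polyIter φ (n + 1)).map (algebraMap ℤ (Kfield φ (n + 1)))).Splits := by
    have := IsSplittingField.splits (Kfield φ (n + 1)) ((polyIter φ (n + 1)).map (algebraMap ℤ ℚ))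
    rwa [Polynomial.map_map, RingHom.ext_int (RingHom.comp _ _) (algebraMap ℤ _)] at this
  have hgen (σ : Kfield φ (n + 1) ≃ₐ[ℚ] Kfield φ (n + 1))
      (h : ∀ x, aeval x (polyIter φ (n + 1)) = 0 → σ x = x) : σ = 1 :=
    AlgEquiv.ext fun x => (forall_mem_Kfield_iff (hmonic _).ne_zero le_rfl σ).2 h x x.2 x.2
  have hswap := exists_swap_polyIter_oddTrinomial hp hk hpk hcase n (Kfield φ (n + 1)) rfl
    hsplits hgen
  rw [relGalCard, Nat.add_sub_cancel, Nat.card_congr (Equiv.subtypeEquivRight fun σ =>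
    forall_mem_Kfield_iff (hmonic _).ne_zero (Kfield_le_Kfield_succ hφ hdeg0 n) σ)]
  rw [hF] at hsplits hgen hswap
  refine (card_algEquiv_fixing_roots hp (by omega) hφ hdeg (hmonic n)
    (hF ▸ irreducible_polyIter_oddTrinomial hp hpk (n + 1)) hsplits hgen hswap).trans ?_
  rw [natDegree_polyIter, hdeg]

/-- **Odoni's conjecture in prime degrees.** For `p ≥ 5` prime, `k ≥ 1` with
`p ∤ k` and `k ≡ 1 (mod 3)` — or `p = 3` and `k = 2` — and `φ(x) = x^p + kp·x^{p-1} - kp`,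
for every `n ≥ 1` the group `Gal(K_n/K_{n-1})` is maximal, i.e. has order `(p!)^(p^(n-1))`;
that is, the arboreal Galois representation of `φ` over `ℚ` is surjective. -/
theorem stmt_0 (p k : ℕ) (hp : p.Prime) (hk : 0 < k) (hpk : ¬ p ∣ k)
    (hcase : (5 ≤ p ∧ k % 3 = 1) ∨ (p = 3 ∧ k = 2))
    (φ : Polynomial ℤ)
    (hφ : φ = X ^ p + C ((k : ℤ) * p) * X ^ (p - 1) - C ((k : ℤ) * p)) :
    ∀ n : ℕ, 1 ≤ n → relGalCard φ n = (Nat.factorial p) ^ (p ^ (n - 1)) := by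
  subst hφ
  intro n hn
  obtain ⟨n, rfl⟩ := Nat.exists_eq_add_of_le' hn
  exact relGalCard_oddTrinomial hp hk hpk hcase n
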